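/- For every q with 0 < q < 1, R(q) = (√5 − 1)/2 − √5 / (1 + ((3 + √5)/2) · exp((1/√5) · ∫_0^q f(-t)^5 / (f(-t^{1/5}) · t^{4/5}) dt)), the improper integral being convergent. -/

import Mathlib

open MeasureTheory Real

/-- Euler's product `f(-q) = ∏_{n=1}^∞ (1 - qⁿ)`. -/
noncomputable def eulerF (q : ℝ) : ℝ := ∏' n : ℕ, (1 - q ^ (n + 1))

/-- `y(q) = f(-q^{1/5}) / (q^{1/5} · f(-q⁵))`. -/
noncomputable def yF (q : ℝ) : ℝ :=
  eulerF (q ^ ((1 : ℝ) / 5)) / (q ^ ((1 : ℝ) / 5) * eulerF (q ^ 5))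

/-- The Rogers–Ramanujan continued fraction, recovered from `y(q)` via
`1/R - 1 - R = y`, `0 < R < 1`. -/
noncomputable def RRcf (q : ℝ) : ℝ :=
  (Real.sqrt (yF q ^ 2 + 2 * yF q + 5) - yF q - 1) / 2

section

open Finset Filter Topology

/-- The finite product `∏_{i=1}^n (1 - q^i)`. -/
noncomputable def qPoch (q : ℝ) (n : ℕ) : ℝ := ∏ i ∈ range n, (1 - q ^ (i + 1))

lemma qPoch_succ (q : ℝ) (n : ℕ) : qPoch q (n + 1) = qPoch q n * (1 - q ^ (n + 1)) :=
  prod_range_succ _ _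

lemma one_sub_pow_pos {q : ℝ} (hq : 0 < q) (hq1 : q < 1) (n : ℕ) : 0 < 1 - q ^ (n + 1) :=
  sub_pos.2 (pow_lt_one₀ hq.le hq1 n.succ_ne_zero)

lemma qPoch_pos {q : ℝ} (hq : 0 < q) (hq1 : q < 1) (n : ℕ) : 0 < qPoch q n :=
  prod_pos fun i _ => one_sub_pow_pos hq hq1 i

lemma summable_neg_pow {q : ℝ} (hq : 0 < q) (hq1 : q < 1) :
    Summable fun n : ℕ => -q ^ (n + 1) :=
  ((summable_nat_add_iff 1).2 (summable_geometric_of_lt_one hq.le hq1)).neg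

lemma tendsto_qPoch {q : ℝ} (hq : 0 < q) (hq1 : q < 1) :
    Tendsto (qPoch q) atTop (𝓝 (eulerF q)) := by
  have h := (Real.multipliable_one_add_of_summable
    (summable_neg_pow hq hq1)).tendsto_prod_tprod_nat
  simp only [← sub_eq_add_neg] at h
  exact h

lemma eulerF_pos {q : ℝ} (hq : 0 < q) (hq1 : q < 1) : 0 < eulerF q := by
  have h := tprod_one_add_ne_zero_of_summable (f := fun n : ℕ => -q ^ (n + 1))
    (fun i => by simpa only [← sub_eq_add_neg] using (one_sub_pow_pos hq hq1 i).ne')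
    (summable_neg_pow hq hq1).norm
  simp only [← sub_eq_add_neg] at h
  exact lt_of_le_of_ne (ge_of_tendsto' (tendsto_qPoch hq hq1)
    fun n => (qPoch_pos hq hq1 n).le) (Ne.symm h)

lemma eulerF_le_qPoch {q : ℝ} (hq : 0 < q) (hq1 : q < 1) (n : ℕ) : eulerF q ≤ qPoch q n := by
  refine Antitone.le_of_tendsto (antitone_nat_of_succ_le fun m => ?_) (tendsto_qPoch hq hq1) n
  rw [qPoch_succ]
  exact mul_le_of_le_one_right (qPoch_pos hq hq1 m).le (by linarith [pow_pos hq (m + 1)])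

lemma qPoch_le_one {q : ℝ} (hq : 0 < q) (hq1 : q < 1) (n : ℕ) : qPoch q n ≤ 1 :=
  prod_le_one (fun i _ => (one_sub_pow_pos hq hq1 i).le) fun i _ => by
    linarith [pow_pos hq (i + 1)]

/-- `1 / ∏_{i=1}^m (1 - q^i)`, extended by `0` to negative `m`. -/
noncomputable def invQPoch (q : ℝ) (m : ℤ) : ℝ := if 0 ≤ m then (qPoch q m.toNat)⁻¹ else 0

lemma invQPoch_natCast (q : ℝ) (n : ℕ) : invQPoch q n = (qPoch q n)⁻¹ := by simp [invQPoch]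

lemma invQPoch_of_neg (q : ℝ) {m : ℤ} (hm : m < 0) : invQPoch q m = 0 := by
  simp [invQPoch, not_le.2 hm]

lemma invQPoch_sub_one {q : ℝ} (hq : 0 < q) (hq1 : q < 1) (m : ℤ) :
    invQPoch q (m - 1) = (1 - q ^ m) * invQPoch q m := by
  rcases lt_trichotomy m 0 with h | rfl | h
  · rw [invQPoch_of_neg _ h, invQPoch_of_neg _ (by lia), mul_zero]
  · rw [invQPoch_of_neg _ (by lia)]; simp
  · obtain ⟨n, rfl⟩ : ∃ n : ℕ, m = ((n + 1 : ℕ) : ℤ) := ⟨m.toNat - 1, by lia⟩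
    have h1 : ((n + 1 : ℕ) : ℤ) - 1 = n := by push_cast; ring
    rw [h1, invQPoch_natCast, invQPoch_natCast, qPoch_succ, zpow_natCast]
    have := one_sub_pow_pos hq hq1 n
    have := qPoch_pos hq hq1 n
    field_simp

lemma invQPoch_nonneg {q : ℝ} (hq : 0 < q) (hq1 : q < 1) (m : ℤ) : 0 ≤ invQPoch q m := by
  unfold invQPoch
  split_ifs
  exacts [(inv_pos.2 (qPoch_pos hq hq1 _)).le, le_rfl]

lemma invQPoch_le {q : ℝ} (hq : 0 < q) (hq1 : q < 1) (m : ℤ) :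
    invQPoch q m ≤ (eulerF q)⁻¹ := by
  unfold invQPoch
  split_ifs
  · exact inv_anti₀ (eulerF_pos hq hq1) (eulerF_le_qPoch hq hq1 _)
  · exact (inv_pos.2 (eulerF_pos hq hq1)).le

lemma tendsto_invQPoch {q : ℝ} (hq : 0 < q) (hq1 : q < 1) (m : ℤ) :
    Tendsto (fun n : ℕ => invQPoch q (n + m)) atTop (𝓝 (eulerF q)⁻¹) := by
  have h : Tendsto (fun n : ℕ => (n + m).toNat) atTop atTop :=
    tendsto_atTop.2 fun b => (eventually_ge_atTop (b + m.natAbs)).mono fun n hn => by lia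
  refine (((tendsto_qPoch hq hq1).comp h).inv₀ (eulerF_pos hq hq1).ne').congr' ?_
  filter_upwards [eventually_ge_atTop m.natAbs] with n hn
  have : 0 ≤ (n : ℤ) + m := by lia
  simp [invQPoch, this]

/-- The Gaussian binomial coefficient `[2n+1 choose n-k]`. -/
noncomputable def centralGauss (q : ℝ) (n : ℕ) (k : ℤ) : ℝ :=
  qPoch q (2 * n + 1) * (invQPoch q (n + -k) * invQPoch q (n + (k + 1)))

lemma centralGauss_succ {q : ℝ} (hq : 0 < q) (hq1 : q < 1) (n : ℕ) (k : ℤ) :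
    centralGauss q (n + 1) k = (1 + (q ^ (n + 1)) ^ 2) * centralGauss q n k
      + q ^ ((n : ℤ) + 1 - k) * centralGauss q n (k - 1)
      + q ^ ((n : ℤ) + k + 2) * centralGauss q n (k + 1) := by
  have e1 := invQPoch_sub_one hq hq1 ((n : ℤ) + 1 - k)
  have e2 := invQPoch_sub_one hq hq1 ((n : ℤ) + 1 - k - 1)
  have e3 := invQPoch_sub_one hq hq1 ((n : ℤ) + k + 2)
  have e4 := invQPoch_sub_one hq hq1 ((n : ℤ) + k + 2 - 1)
  have z1 : q ^ ((n : ℤ) + 1 - k) = q ^ ((n : ℤ) - k) * q := by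
    rw [← zpow_add_one₀ hq.ne']; congr 1; ring
  have z2 : q ^ ((n : ℤ) + 1 - k - 1) = q ^ ((n : ℤ) - k) := by congr 1; ring
  have z3 : q ^ ((n : ℤ) + k + 2) = q ^ ((n : ℤ) + k + 1) * q := by
    rw [← zpow_add_one₀ hq.ne']; congr 1; ring
  have z4 : q ^ ((n : ℤ) + k + 2 - 1) = q ^ ((n : ℤ) + k + 1) := by congr 1; ring
  have z5 : q ^ (2 * n + 1) = q ^ ((n : ℤ) - k) * q ^ ((n : ℤ) + k + 1) := by
    rw [← zpow_add₀ hq.ne', ← zpow_natCast]; congr 1; push_cast; ring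
  have z6 : (q ^ (n + 1)) ^ 2 = q ^ (2 * n + 1) * q := by ring
  have z7 : q ^ (2 * n + 1 + 1) = q ^ (2 * n + 1) * q := by ring
  have z8 : q ^ (2 * n + 1 + 1 + 1) = q ^ (2 * n + 1) * q ^ 2 := by ring
  have s : 2 * (n + 1) + 1 = 2 * n + 1 + 1 + 1 := by ring
  unfold centralGauss
  rw [s, qPoch_succ q (2 * n + 1 + 1), qPoch_succ q (2 * n + 1)]
  have a1 : (((n + 1 : ℕ) : ℤ) + -k) = (n : ℤ) + 1 - k := by push_cast; ring
  have a2 : (((n + 1 : ℕ) : ℤ) + (k + 1)) = (n : ℤ) + k + 2 := by push_cast; ring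
  have a3 : ((n : ℤ) + -k) = (n : ℤ) + 1 - k - 1 := by ring
  have a4 : ((n : ℤ) + (k + 1)) = (n : ℤ) + k + 2 - 1 := by ring
  have a5 : ((n : ℤ) + -(k - 1)) = (n : ℤ) + 1 - k := by ring
  have a6 : ((n : ℤ) + (k - 1 + 1)) = (n : ℤ) + k + 2 - 1 - 1 := by ring
  have a7 : ((n : ℤ) + -(k + 1)) = (n : ℤ) + 1 - k - 1 - 1 := by ring
  have a8 : ((n : ℤ) + (k + 1 + 1)) = (n : ℤ) + k + 2 := by ring
  rw [a1, a2, a3, a4, a5, a6, a7, a8, e2, e4, e1, e3, z2, z4, z1, z3, z6, z7, z8, z5]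
  ring

lemma centralGauss_neg_one (q : ℝ) (n : ℕ) : centralGauss q n (-1) = centralGauss q n 0 := by
  simp [centralGauss, mul_comm]

lemma centralGauss_of_lt (q : ℝ) {n k : ℕ} (h : n < k) : centralGauss q n k = 0 := by
  rw [centralGauss, invQPoch_of_neg q (m := n + -k) (by lia)]; ring

lemma centralGauss_nonneg {q : ℝ} (hq : 0 < q) (hq1 : q < 1) (n : ℕ) (k : ℤ) :
    0 ≤ centralGauss q n k :=
  mul_nonneg (qPoch_pos hq hq1 _).le
    (mul_nonneg (invQPoch_nonneg hq hq1 _) (invQPoch_nonneg hq hq1 _))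

lemma centralGauss_le {q : ℝ} (hq : 0 < q) (hq1 : q < 1) (n : ℕ) (k : ℤ) :
    centralGauss q n k ≤ (eulerF q)⁻¹ * (eulerF q)⁻¹ := by
  rw [← one_mul ((eulerF q)⁻¹ * (eulerF q)⁻¹)]
  have h := (inv_pos.2 (eulerF_pos hq hq1)).le
  exact mul_le_mul (qPoch_le_one hq hq1 _)
    (mul_le_mul (invQPoch_le hq hq1 _) (invQPoch_le hq hq1 _) (invQPoch_nonneg hq hq1 _) h)
    (mul_nonneg (invQPoch_nonneg hq hq1 _) (invQPoch_nonneg hq hq1 _)) zero_le_one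

lemma tendsto_centralGauss {q : ℝ} (hq : 0 < q) (hq1 : q < 1) (k : ℤ) :
    Tendsto (fun n => centralGauss q n k) atTop (𝓝 (eulerF q)⁻¹) := by
  have h : Tendsto (fun n : ℕ => 2 * n + 1) atTop atTop :=
    tendsto_atTop.2 fun b => (eventually_ge_atTop b).mono fun n hn => by lia
  have h2 := ((tendsto_qPoch hq hq1).comp h).mul
    ((tendsto_invQPoch hq hq1 (-k)).mul (tendsto_invQPoch hq hq1 (k + 1)))
  have h3 := (eulerF_pos hq hq1).ne'
  have h4 : eulerF q * ((eulerF q)⁻¹ * (eulerF q)⁻¹) = (eulerF q)⁻¹ := by field_simp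
  rw [h4] at h2
  exact h2

lemma sum_range_mul_chebyshev_recurrence {c x : ℝ} {D b b' : ℕ → ℝ} (hD0 : D 0 = 1)
    (hD1 : D 1 = 1 + c) (hD : ∀ k, D (k + 2) = c * D (k + 1) - D k)
    (hb0 : b' 0 = (1 + x ^ 2) * b 0 - x * (-b 0 + b 1))
    (hb : ∀ k, b' (k + 1) = (1 + x ^ 2) * b (k + 1) - x * (b k + b (k + 2))) (N : ℕ) :
    ∑ k ∈ range (N + 1), b' k * D k = (1 - c * x + x ^ 2) * ∑ k ∈ range (N + 1), b k * D k
      - x * (b (N + 1) * D N - b N * D (N + 1)) := by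
  induction N with
  | zero => simp [hD0, hD1, hb0]; ring
  | succ N ih => rw [sum_range_succ, ih, sum_range_succ _ (N + 1), hb, hD]; ring

lemma triangle_succ (k : ℕ) : (k + 1) * (k + 1 + 1) / 2 = k * (k + 1) / 2 + (k + 1) := by
  rw [show (k + 1) * (k + 1 + 1) = k * (k + 1) + (k + 1) * 2 by ring,
    Nat.add_mul_div_right _ _ two_pos]

lemma prod_eq_sum_centralGauss {q c : ℝ} (hq : 0 < q) (hq1 : q < 1) {D : ℕ → ℝ} (hD0 : D 0 = 1)
    (hD1 : D 1 = 1 + c) (hD : ∀ k, D (k + 2) = c * D (k + 1) - D k) (n : ℕ) :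
    ∏ i ∈ range n, (1 - c * q ^ (i + 1) + (q ^ (i + 1)) ^ 2) =
      ∑ k ∈ range (n + 1), (-1) ^ k * q ^ (k * (k + 1) / 2) * centralGauss q n k * D k := by
  induction n with
  | zero =>
    have : qPoch q 1 ≠ 0 := (qPoch_pos hq hq1 1).ne'
    have h0 := invQPoch_natCast q 0
    have h1 := invQPoch_natCast q 1
    simp only [Nat.cast_zero, Nat.cast_one] at h0 h1
    simp [centralGauss, hD0, h0, h1, qPoch] at *
    field_simp
  | succ n ih =>
    rw [prod_range_succ, ih]
    have key := sum_range_mul_chebyshev_recurrence (x := q ^ (n + 1))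
      (b := fun k => (-1) ^ k * q ^ (k * (k + 1) / 2) * centralGauss q n k)
      (b' := fun k => (-1) ^ k * q ^ (k * (k + 1) / 2) * centralGauss q (n + 1) k) hD0 hD1 hD
      ?_ ?_ (n + 1)
    · rw [key, sum_range_succ _ (n + 1)]
      have h1 := centralGauss_of_lt q (show n < n + 1 by lia)
      have h2 := centralGauss_of_lt q (show n < n + 1 + 1 by lia)
      rw [h1, h2]
      ring
    · have h := centralGauss_succ hq hq1 n 0
      have e1 : q ^ ((n : ℤ) + 1 - 0) = q ^ (n + 1) := by
        rw [← zpow_natCast]; congr 1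
      have e2 : q ^ ((n : ℤ) + 0 + 2) = q ^ (n + 1) * q := by
        rw [← pow_succ, ← zpow_natCast]; congr 1
      rw [zero_sub, centralGauss_neg_one, e1, e2, zero_add] at h
      simp [h]
      ring
    · intro k
      have h := centralGauss_succ hq hq1 n ((k + 1 : ℕ) : ℤ)
      have c1 : ((k + 1 : ℕ) : ℤ) - 1 = k := by push_cast; ring
      have c2 : ((k + 1 : ℕ) : ℤ) + 1 = (k + 2 : ℕ) := by push_cast; ring
      have e1 : q ^ ((n : ℤ) + 1 - (k + 1 : ℕ)) * q ^ (k + 1) = q ^ (n + 1) := by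
        rw [← zpow_natCast, ← zpow_natCast, ← zpow_add₀ hq.ne']; congr 1; push_cast; ring
      have e2 : q ^ ((n : ℤ) + (k + 1 : ℕ) + 2) = q ^ (n + 1) * q ^ (k + 2) := by
        rw [← pow_add, ← zpow_natCast]; congr 1; push_cast; ring
      rw [c1, c2, e2] at h
      simp only [triangle_succ k, triangle_succ (k + 1), h, show k + 2 = k + 1 + 1 from rfl]
      rw [pow_add q (k * (k + 1) / 2), pow_add q (k * (k + 1) / 2 + (k + 1)),
        pow_add q (k * (k + 1) / 2), ← e1]
      ring

/-- Jacobi's triple product identity, with `D k` the Dirichlet kernel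
`z^(-k) + ⋯ + z^k` as a polynomial in `c = z + z⁻¹`. -/
lemma tendsto_prod_jacobi {q c : ℝ} (hq : 0 < q) (hq1 : q < 1) {D : ℕ → ℝ} (hD0 : D 0 = 1)
    (hD1 : D 1 = 1 + c) (hD : ∀ k, D (k + 2) = c * D (k + 1) - D k)
    (hs : Summable fun k : ℕ => q ^ (k * (k + 1) / 2) * |D k|) :
    Tendsto (fun n => ∏ i ∈ range n, (1 - c * q ^ (i + 1) + (q ^ (i + 1)) ^ 2)) atTop
      (𝓝 ((eulerF q)⁻¹ * ∑' k : ℕ, (-1) ^ k * q ^ (k * (k + 1) / 2) * D k)) := by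
  have key := tendsto_tsum_of_dominated_convergence (𝓕 := atTop)
    (f := fun n k : ℕ => (-1) ^ k * q ^ (k * (k + 1) / 2) * centralGauss q n k * D k)
    (g := fun k : ℕ => (-1) ^ k * q ^ (k * (k + 1) / 2) * (eulerF q)⁻¹ * D k)
    (bound := fun k : ℕ => (eulerF q)⁻¹ * (eulerF q)⁻¹ * (q ^ (k * (k + 1) / 2) * |D k|))
    (hs.mul_left _)
    (fun k => ((tendsto_centralGauss hq hq1 k).const_mul _).mul_const _)
    (Eventually.of_forall fun n k => by
      rw [norm_mul, norm_mul, norm_mul, norm_pow, norm_neg, norm_one, one_pow, one_mul,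
        Real.norm_of_nonneg (centralGauss_nonneg hq hq1 n k), Real.norm_of_nonneg (by positivity),
        Real.norm_eq_abs, mul_right_comm, mul_comm]
      exact mul_le_mul_of_nonneg_right (centralGauss_le hq hq1 n k) (by positivity))
  rw [← tsum_mul_left]
  convert key using 1
  · ext n
    rw [prod_eq_sum_centralGauss hq hq1 hD0 hD1 hD, tsum_eq_sum]
    intro k hk
    rw [centralGauss_of_lt q (by simpa using hk)]
    ring
  · congr 1
    exact tsum_congr fun k => by ring

lemma two_mul_triangle (k : ℕ) : 2 * (k * (k + 1) / 2) = k * (k + 1) :=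
  Nat.mul_div_cancel' (Nat.even_mul_succ_self k).two_dvd

lemma triangle_injective : Function.Injective fun k : ℕ => k * (k + 1) / 2 :=
  (strictMono_nat_of_lt_succ fun k => by rw [triangle_succ]; lia).injective

lemma le_triangle (k : ℕ) : k ≤ k * (k + 1) / 2 := by
  have := two_mul_triangle k
  nlinarith [Nat.zero_le k, Nat.le_mul_self k]

lemma summable_two_mul_add_one_mul_pow {q : ℝ} (hq : 0 < q) (hq1 : q < 1) :
    Summable fun n : ℕ => (2 * (n : ℝ) + 1) * q ^ n := by
  have h1 := summable_pow_mul_geometric_of_norm_lt_one 1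
    (show ‖q‖ < 1 by rwa [Real.norm_of_nonneg hq.le])
  have h2 := summable_geometric_of_lt_one hq.le hq1
  refine ((h1.mul_left 2).add h2).congr fun n => ?_
  ring

lemma summable_triangle_mul_abs {q : ℝ} (hq : 0 < q) (hq1 : q < 1) {D : ℕ → ℝ}
    (hD : ∀ k, |D k| ≤ 2 * k + 1) :
    Summable fun k : ℕ => q ^ (k * (k + 1) / 2) * |D k| := by
  refine Summable.of_nonneg_of_le (fun k => by positivity) (fun k => ?_)
    ((summable_two_mul_add_one_mul_pow hq hq1).comp_injective triangle_injective)
  have h : (k : ℝ) ≤ ((k * (k + 1) / 2 : ℕ) : ℝ) := mod_cast le_triangle k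
  simp only [Function.comp_apply]
  rw [mul_comm]
  gcongr
  linarith [hD k]

/-- Jacobi's identity for the cube of Euler's product. -/
lemma tsum_jacobi_cube {q : ℝ} (hq : 0 < q) (hq1 : q < 1) :
    ∑' k : ℕ, (-1 : ℝ) ^ k * q ^ (k * (k + 1) / 2) * (2 * k + 1) = eulerF q ^ 3 := by
  have h := tendsto_prod_jacobi (c := 2) (D := fun k : ℕ => 2 * (k : ℝ) + 1) hq hq1 (by simp)
    (by norm_num) (fun k => by push_cast; ring)
    (summable_triangle_mul_abs hq hq1 fun k => (abs_of_nonneg (by positivity)).le)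
  have h2 : (fun n => ∏ i ∈ range n, (1 - 2 * q ^ (i + 1) + (q ^ (i + 1)) ^ 2)) =
      fun n => qPoch q n ^ 2 := by
    ext n
    rw [qPoch, ← prod_pow]
    exact prod_congr rfl fun i _ => by ring
  rw [h2] at h
  have h3 := tendsto_nhds_unique h ((tendsto_qPoch hq hq1).pow 2)
  have h4 := (eulerF_pos hq hq1).ne'
  field_simp at h3
  linarith

/-- The exponent `n (5 n + a) / 2`. -/
def thetaExp (a n : ℤ) : ℕ := (n * (5 * n + a) / 2).toNat

lemma two_mul_thetaExp {a : ℤ} (ha : Odd a) (h0 : 0 < a) (h5 : a < 5) (n : ℤ) :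
    2 * (thetaExp a n : ℤ) = n * (5 * n + a) := by
  have hev : Even (n * (5 * n + a)) := by
    rcases Int.even_or_odd n with h | h
    · exact h.mul_right _
    · exact Even.mul_left (((by decide : Odd (5 : ℤ)).mul h).add_odd ha) _
  have hnn : 0 ≤ n * (5 * n + a) := by
    rcases le_or_gt 0 n with h | h
    · positivity
    · exact mul_nonneg_of_nonpos_of_nonpos h.le (by lia)
  obtain ⟨m, hm⟩ := hev
  have hm' : thetaExp a n = m.toNat := by rw [thetaExp, hm]; lia
  rw [hm', hm]
  lia

lemma thetaExp_injective {a : ℤ} (ha : Odd a) (h0 : 0 < a) (h5 : a < 5) :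
    Function.Injective (thetaExp a) := by
  intro n m h
  have hn := two_mul_thetaExp ha h0 h5 n
  rw [h, two_mul_thetaExp ha h0 h5 m] at hn
  have : (n - m) * (5 * (n + m) + a) = 0 := by linarith
  rcases mul_eq_zero.1 this with h | h <;> lia

/-- The theta series `∑ (-1)ⁿ q^(n (5 n + a) / 2)` over the integers. -/
noncomputable def rrTheta (a : ℤ) (q : ℝ) : ℝ := ∑' n : ℤ, (-1 : ℝ) ^ n * q ^ thetaExp a n

lemma neg_one_zpow_neg_add_one (k : ℕ) : (-1 : ℝ) ^ (-((k : ℤ) + 1)) = -(-1) ^ k := by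
  rw [zpow_neg, zpow_add₀ (by norm_num), zpow_natCast, zpow_one, mul_neg_one, inv_neg, ← inv_pow,
    inv_neg, inv_one]

lemma summable_rrTheta {a : ℤ} (ha : Odd a) (h0 : 0 < a) (h5 : a < 5) {q : ℝ} (hq : 0 < q)
    (hq1 : q < 1) : Summable fun n : ℤ => (-1 : ℝ) ^ n * q ^ thetaExp a n := by
  refine Summable.of_norm_bounded ((summable_geometric_of_lt_one hq.le hq1).comp_injective
    (thetaExp_injective ha h0 h5)) fun n => ?_
  rw [norm_mul, Real.norm_eq_abs, abs_neg_one_zpow, one_mul, Real.norm_of_nonneg (by positivity)]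
  rfl

lemma summable_rrTheta_nat {a : ℤ} (ha : Odd a) (h0 : 0 < a) (h5 : a < 5) {q : ℝ} (hq : 0 < q)
    (hq1 : q < 1) :
    Summable fun k : ℕ => (-1 : ℝ) ^ k * (q ^ thetaExp a k - q ^ thetaExp a (-(k + 1))) := by
  have h := summable_rrTheta ha h0 h5 hq hq1
  have h1 := h.comp_injective (i := fun k : ℕ => (k : ℤ)) fun _ _ h => by simpa using h
  have h2 := h.comp_injective (i := fun k : ℕ => -((k : ℤ) + 1)) fun _ _ h => by simpa using h
  refine (h1.add h2).congr fun k => ?_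
  simp only [Function.comp_apply, neg_one_zpow_neg_add_one, zpow_natCast]
  ring

lemma rrTheta_eq_tsum_nat {a : ℤ} (ha : Odd a) (h0 : 0 < a) (h5 : a < 5) {q : ℝ} (hq : 0 < q)
    (hq1 : q < 1) :
    rrTheta a q =
      ∑' k : ℕ, (-1 : ℝ) ^ k * (q ^ thetaExp a k - q ^ thetaExp a (-(k + 1))) := by
  have h := summable_rrTheta ha h0 h5 hq hq1
  unfold rrTheta
  generalize hf : (fun n : ℤ => (-1 : ℝ) ^ n * q ^ thetaExp a n) = f at h ⊢
  have h1 : Summable fun k : ℕ => f k :=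
    h.comp_injective (i := fun k : ℕ => (k : ℤ)) fun _ _ h => by simpa using h
  have h2 : Summable fun k : ℕ => f (-(k + 1)) :=
    h.comp_injective (i := fun k : ℕ => -((k : ℤ) + 1)) fun _ _ h => by simpa using h
  rw [tsum_of_nat_of_neg_add_one h1 h2, ← h1.tsum_add h2]
  refine tsum_congr fun k => ?_
  simp only [← hf, neg_one_zpow_neg_add_one, zpow_natCast]
  ring

lemma tendsto_prod_rrTheta {a : ℤ} (ha : Odd a) (h0 : 0 < a) (h5 : a < 5) {q : ℝ} (hq : 0 < q)
    (hq1 : q < 1) {j : ℕ} (hj : 0 < j) (haj : a + 2 * j = 5) :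
    Tendsto (fun n => ∏ i ∈ range n,
      ((1 - q ^ j * (q ^ 5) ^ (i + 1)) * (1 - (q ^ j)⁻¹ * (q ^ 5) ^ (i + 1)))) atTop
      (𝓝 ((eulerF (q ^ 5))⁻¹ * (rrTheta a q / (1 - q ^ j)))) := by
  have hp : 0 < q ^ 5 := by positivity
  have hp1 : q ^ 5 < 1 := pow_lt_one₀ hq.le hq1 (by norm_num)
  have hz : 0 < q ^ j := by positivity
  have hz1 : q ^ j < 1 := pow_lt_one₀ hq.le hq1 hj.ne'
  have hz2 : 1 - q ^ j ≠ 0 := by linarith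
  set D : ℕ → ℝ := fun k => ((q ^ j)⁻¹ ^ k - (q ^ j) ^ (k + 1)) / (1 - q ^ j) with hDdef
  have hterm : ∀ k : ℕ, (-1 : ℝ) ^ k * (q ^ 5) ^ (k * (k + 1) / 2) * D k =
      (-1 : ℝ) ^ k * (q ^ thetaExp a k - q ^ thetaExp a (-(k + 1))) / (1 - q ^ j) := by
    intro k
    have t := two_mul_triangle k
    have e1 := two_mul_thetaExp ha h0 h5 k
    have e2 := two_mul_thetaExp ha h0 h5 (-(k + 1))
    generalize k * (k + 1) / 2 = T at t ⊢
    have f1 : 5 * T = thetaExp a k + j * k := by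
      zify at t ⊢
      rw [← mul_right_inj' (two_ne_zero (α := ℤ)), mul_add, e1, show a = 5 - 2 * j by lia]
      linear_combination 5 * t
    have f2 : thetaExp a (-(k + 1)) = 5 * T + j * (k + 1) := by
      zify at t ⊢
      rw [← mul_right_inj' (two_ne_zero (α := ℤ)), mul_add, e2, show a = 5 - 2 * j by lia]
      linear_combination -5 * t
    have g1 : (q ^ 5) ^ T * (q ^ j)⁻¹ ^ k = q ^ thetaExp a k := by
      rw [← pow_mul, f1, pow_add, pow_mul, mul_assoc, ← mul_pow, mul_inv_cancel₀ hz.ne', one_pow,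
        mul_one]
    have g2 : (q ^ 5) ^ T * (q ^ j) ^ (k + 1) = q ^ thetaExp a (-(k + 1)) := by
      rw [f2, ← pow_mul, ← pow_mul, ← pow_add]
    rw [hDdef, ← g1, ← g2]
    ring
  have h := tendsto_prod_jacobi (c := q ^ j + (q ^ j)⁻¹) (D := D) hp hp1
    (by simp [hDdef, hz2]) (by simp only [hDdef]; field_simp; ring)
    (fun k => by
      have hw : q ^ j * (q ^ j)⁻¹ = 1 := mul_inv_cancel₀ hz.ne'
      simp only [hDdef]
      generalize (q ^ j)⁻¹ = w at hw
      generalize q ^ j = z at hw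
      rw [mul_div_assoc', ← sub_div]
      congr 1
      linear_combination -(w ^ k - z ^ (k + 1)) * hw) ?_
  · rw [rrTheta_eq_tsum_nat ha h0 h5 hq hq1, ← tsum_div_const]
    simp only [hterm] at h
    refine h.congr fun n => prod_congr rfl fun i _ => ?_
    field_simp
    ring
  · refine (((summable_rrTheta_nat ha h0 h5 hq hq1).div_const (1 - q ^ j)).abs).congr fun k => ?_
    rw [← hterm, abs_mul, abs_mul, abs_pow, abs_neg, abs_one, one_pow, one_mul,
      abs_of_pos (pow_pos hp _)]

lemma prod_mul_prod_mul_qPoch {q : ℝ} (hq : 0 < q) (n : ℕ) :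
    (1 - q) * (1 - q ^ 2) * ((∏ i ∈ range n,
      ((1 - q ^ 1 * (q ^ 5) ^ (i + 1)) * (1 - (q ^ 1)⁻¹ * (q ^ 5) ^ (i + 1)))) *
      (∏ i ∈ range n,
      ((1 - q ^ 2 * (q ^ 5) ^ (i + 1)) * (1 - (q ^ 2)⁻¹ * (q ^ 5) ^ (i + 1)))) *
      qPoch (q ^ 5) n) = qPoch q (5 * n + 2) := by
  induction n with
  | zero => simp [qPoch, prod_range_succ]
  | succ n ih =>
    rw [show 5 * (n + 1) + 2 = 5 * n + 2 + 1 + 1 + 1 + 1 + 1 by ring]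
    simp only [qPoch_succ _ (5 * n + 2 + 1 + 1 + 1 + 1), qPoch_succ _ (5 * n + 2 + 1 + 1 + 1),
      qPoch_succ _ (5 * n + 2 + 1 + 1), qPoch_succ _ (5 * n + 2 + 1), qPoch_succ _ (5 * n + 2),
      qPoch_succ _ n, ← ih]
    rw [prod_range_succ, prod_range_succ]
    generalize (∏ i ∈ range n, ((1 - q ^ 1 * (q ^ 5) ^ (i + 1)) *
      (1 - (q ^ 1)⁻¹ * (q ^ 5) ^ (i + 1)))) = P₁
    generalize (∏ i ∈ range n, ((1 - q ^ 2 * (q ^ 5) ^ (i + 1)) *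
      (1 - (q ^ 2)⁻¹ * (q ^ 5) ^ (i + 1)))) = P₂
    have h1 : (q ^ 1)⁻¹ * (q ^ 5) ^ (n + 1) = q ^ (5 * n + 4) := by
      field_simp; ring
    have h2 : (q ^ 2)⁻¹ * (q ^ 5) ^ (n + 1) = q ^ (5 * n + 3) := by
      field_simp; ring
    rw [h1, h2]
    ring

lemma rrTheta_three_mul_rrTheta_one {q : ℝ} (hq : 0 < q) (hq1 : q < 1) :
    rrTheta 3 q * rrTheta 1 q = eulerF q * eulerF (q ^ 5) := by
  have hp : 0 < q ^ 5 := by positivity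
  have hp1 : q ^ 5 < 1 := pow_lt_one₀ hq.le hq1 (by norm_num)
  have hA := tendsto_prod_rrTheta (a := 3) (by decide) (by norm_num) (by norm_num) hq hq1
    (j := 1) (by norm_num) (by norm_num)
  have hB := tendsto_prod_rrTheta (a := 1) (by decide) (by norm_num) (by norm_num) hq hq1
    (j := 2) (by norm_num) (by norm_num)
  have h := ((hA.mul hB).mul (tendsto_qPoch hp hp1)).const_mul ((1 - q) * (1 - q ^ 2))
  simp only [prod_mul_prod_mul_qPoch hq] at h
  have hsub : Tendsto (fun n : ℕ => 5 * n + 2) atTop atTop :=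
    tendsto_atTop.2 fun b => (eventually_ge_atTop b).mono fun n hn => by lia
  have h2 := tendsto_nhds_unique h ((tendsto_qPoch hq hq1).comp hsub)
  have h3 := (eulerF_pos hp hp1).ne'
  have h4 : 1 - q ≠ 0 := by linarith
  have h5 : 1 - q ^ 2 ≠ 0 := by nlinarith
  rw [← h2, pow_one]
  field_simp

lemma rrTheta_nonneg {a : ℤ} (ha : Odd a) (h0 : 0 < a) (h5 : a < 5) {q : ℝ} (hq : 0 < q)
    (hq1 : q < 1) {j : ℕ} (hj : 0 < j) (haj : a + 2 * j = 5) : 0 ≤ rrTheta a q := by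
  have hp : 0 < q ^ 5 := by positivity
  have hp1 : q ^ 5 < 1 := pow_lt_one₀ hq.le hq1 (by norm_num)
  have hz : 0 < q ^ j := by positivity
  have hz1 : q ^ j < 1 := pow_lt_one₀ hq.le hq1 hj.ne'
  have h := ge_of_tendsto' (b := (0 : ℝ)) (tendsto_prod_rrTheta ha h0 h5 hq hq1 hj haj)
    fun n => prod_nonneg fun i _ => by
      have e1 : q ^ j * (q ^ 5) ^ (i + 1) ≤ 1 :=
        mul_le_one₀ hz1.le (by positivity) (pow_le_one₀ hp.le hp1.le)
      have e2 : (q ^ j)⁻¹ * (q ^ 5) ^ (i + 1) ≤ 1 := by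
        rw [inv_mul_le_iff₀ hz, mul_one, ← pow_mul]
        exact pow_le_pow_of_le_one hq.le hq1.le (by lia)
      exact mul_nonneg (by linarith) (by linarith)
  by_contra hneg
  have : rrTheta a q / (1 - q ^ j) < 0 := div_neg_of_neg_of_pos (not_le.1 hneg) (by linarith)
  exact absurd h (not_le.2 (mul_neg_of_pos_of_neg (inv_pos.2 (eulerF_pos hp hp1)) this))

lemma rrTheta_three_pos {q : ℝ} (hq : 0 < q) (hq1 : q < 1) : 0 < rrTheta 3 q := by
  have h := rrTheta_three_mul_rrTheta_one hq hq1
  have h1 := mul_pos (eulerF_pos hq hq1)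
    (eulerF_pos (q := q ^ 5) (by positivity) (pow_lt_one₀ hq.le hq1 (by norm_num)))
  refine lt_of_le_of_ne (rrTheta_nonneg (by decide) (by norm_num) (by norm_num) hq hq1
    (j := 1) (by norm_num) (by norm_num)) fun h2 => ?_
  rw [← h2, zero_mul] at h
  linarith

lemma rrTheta_one_pos {q : ℝ} (hq : 0 < q) (hq1 : q < 1) : 0 < rrTheta 1 q := by
  have h := rrTheta_three_mul_rrTheta_one hq hq1
  have h1 := mul_pos (eulerF_pos hq hq1)
    (eulerF_pos (q := q ^ 5) (by positivity) (pow_lt_one₀ hq.le hq1 (by norm_num)))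
  exact pos_of_mul_pos_right (h ▸ h1) (rrTheta_three_pos hq hq1).le

/-- The sequence of Dirichlet kernels at a primitive fifth root of unity `z`, `c = z + z⁻¹`. -/
noncomputable def fiveKernel (c : ℝ) (k : ℕ) : ℝ :=
  if k % 5 = 0 then 1 else if k % 5 = 1 then 1 + c else if k % 5 = 2 then 0
  else if k % 5 = 3 then -(1 + c) else -1

lemma fiveKernel_add_two {c : ℝ} (hc : c ^ 2 + c = 1) (k : ℕ) :
    fiveKernel c (k + 2) = c * fiveKernel c (k + 1) - fiveKernel c k := by
  have h5 : k % 5 = 0 ∨ k % 5 = 1 ∨ k % 5 = 2 ∨ k % 5 = 3 ∨ k % 5 = 4 := by lia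
  rcases h5 with h | h | h | h | h <;> simp [fiveKernel, Nat.add_mod, h] <;> linarith

lemma abs_fiveKernel_le {c : ℝ} (hc : c ^ 2 + c = 1) (k : ℕ) : |fiveKernel c k| ≤ 2 * k + 1 := by
  rcases Nat.eq_zero_or_pos k with rfl | hk
  · simp [fiveKernel]
  · have h1 : (1 : ℝ) ≤ k := by exact_mod_cast hk
    have hc1 : -2 ≤ c := by nlinarith
    have hc2 : c ≤ 1 := by nlinarith
    unfold fiveKernel
    rw [abs_le]
    split_ifs <;> constructor <;> linarith

lemma tsum_fiveKernel {q c : ℝ} (hq : 0 < q) (hq1 : q < 1) (hc : c ^ 2 + c = 1) :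
    ∑' k : ℕ, (-1 : ℝ) ^ k * q ^ (k * (k + 1) / 2) * fiveKernel c k =
      rrTheta 1 (q ^ 5) - (1 + c) * q * rrTheta 3 (q ^ 5) := by
  have hp : 0 < q ^ 5 := by positivity
  have hp1 : q ^ 5 < 1 := pow_lt_one₀ hq.le hq1 (by norm_num)
  have hs : Summable fun k : ℕ => (-1 : ℝ) ^ k * q ^ (k * (k + 1) / 2) * fiveKernel c k := by
    refine Summable.of_norm_bounded (summable_triangle_mul_abs hq hq1 (abs_fiveKernel_le hc))
      fun k => le_of_eq ?_
    rw [norm_mul, norm_mul, norm_pow, norm_neg, norm_one, one_pow, one_mul,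
      Real.norm_of_nonneg (by positivity), Real.norm_eq_abs]
  have ho1 : Odd (1 : ℤ) := by decide
  have ho3 : Odd (3 : ℤ) := by decide
  have s1 := summable_rrTheta_nat ho1 (by norm_num) (by norm_num) hp hp1
  have s3 := summable_rrTheta_nat ho3 (by norm_num) (by norm_num) hp hp1
  have hinj : ∀ j : ℕ, Function.Injective fun m : ℕ => j + 5 * m := fun j a b h => by
    simp only at h; lia
  generalize hF : (fun k : ℕ => (-1 : ℝ) ^ k * q ^ (k * (k + 1) / 2) * fiveKernel c k) = F at hs ⊢
  have hr := fun j => hs.comp_injective (hinj j)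
  rw [Nat.sumByResidueClasses hs 5]
  change ∑ j : Fin 5, _ = _
  rw [Fin.sum_univ_five]
  change (∑' m : ℕ, (F ∘ fun m : ℕ => 0 + 5 * m) m) + (∑' m : ℕ, (F ∘ fun m : ℕ => 1 + 5 * m) m)
    + (∑' m : ℕ, (F ∘ fun m : ℕ => 2 + 5 * m) m) + (∑' m : ℕ, (F ∘ fun m : ℕ => 3 + 5 * m) m)
    + (∑' m : ℕ, (F ∘ fun m : ℕ => 4 + 5 * m) m) = _
  rw [← (hr 0).tsum_add (hr 1), ← ((hr 0).add (hr 1)).tsum_add (hr 2),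
    ← (((hr 0).add (hr 1)).add (hr 2)).tsum_add (hr 3),
    ← ((((hr 0).add (hr 1)).add (hr 2)).add (hr 3)).tsum_add (hr 4),
    rrTheta_eq_tsum_nat ho1 (by norm_num) (by norm_num) hp hp1,
    rrTheta_eq_tsum_nat ho3 (by norm_num) (by norm_num) hp hp1, ← tsum_mul_left,
    ← s1.tsum_sub (s3.mul_left _)]
  refine tsum_congr fun m => ?_
  have a1 := two_mul_thetaExp ho1 (by norm_num) (by norm_num) m
  have a2 := two_mul_thetaExp ho1 (by norm_num) (by norm_num) (-(m + 1))
  have a3 := two_mul_thetaExp ho3 (by norm_num) (by norm_num) m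
  have a4 := two_mul_thetaExp ho3 (by norm_num) (by norm_num) (-(m + 1))
  have b1 : (0 + 5 * m) * (0 + 5 * m + 1) / 2 = 5 * thetaExp 1 m := by
    refine Nat.div_eq_of_eq_mul_right two_pos ?_
    zify; linear_combination -5 * a1
  have b2 : (4 + 5 * m) * (4 + 5 * m + 1) / 2 = 5 * thetaExp 1 (-(m + 1)) := by
    refine Nat.div_eq_of_eq_mul_right two_pos ?_
    zify; linear_combination -5 * a2
  have b3 : (1 + 5 * m) * (1 + 5 * m + 1) / 2 = 5 * thetaExp 3 m + 1 := by
    refine Nat.div_eq_of_eq_mul_right two_pos ?_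
    zify; linear_combination -5 * a3
  have b4 : (3 + 5 * m) * (3 + 5 * m + 1) / 2 = 5 * thetaExp 3 (-(m + 1)) + 1 := by
    refine Nat.div_eq_of_eq_mul_right two_pos ?_
    zify; linear_combination -5 * a4
  have hm : ((-1 : ℝ) ^ m) ^ 5 = (-1) ^ m := by
    rw [← pow_mul, mul_comm, pow_mul]; norm_num
  simp only [Function.comp_apply, ← hF, b1, b2, b3, b4, fiveKernel, pow_add (-1 : ℝ), ← pow_mul q]
  rw [mul_comm 5 m, pow_mul (-1 : ℝ) m 5, hm]
  have r0 : (0 + m * 5) % 5 = 0 := by lia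
  have r1 : (1 + m * 5) % 5 = 1 := by lia
  have r2 : (2 + m * 5) % 5 = 2 := by lia
  have r3 : (3 + m * 5) % 5 = 3 := by lia
  have r4 : (4 + m * 5) % 5 = 4 := by lia
  simp only [r0, r1, r2, r3, r4]
  norm_num
  ring

lemma rrTheta_sq_sub {q : ℝ} (hq : 0 < q) (hq1 : q < 1) :
    rrTheta 1 (q ^ 5) ^ 2 - q * rrTheta 3 (q ^ 5) * rrTheta 1 (q ^ 5)
      - q ^ 2 * rrTheta 3 (q ^ 5) ^ 2 = eulerF q * eulerF (q ^ 5) := by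
  have hp : 0 < q ^ 5 := by positivity
  have hp1 : q ^ 5 < 1 := pow_lt_one₀ hq.le hq1 (by norm_num)
  have h5 : √5 ^ 2 = (5 : ℝ) := Real.sq_sqrt (by norm_num)
  have lim : ∀ c : ℝ, c ^ 2 + c = 1 →
      Tendsto (fun n => ∏ i ∈ range n, (1 - c * q ^ (i + 1) + (q ^ (i + 1)) ^ 2)) atTop
      (𝓝 ((eulerF q)⁻¹ * (rrTheta 1 (q ^ 5) - (1 + c) * q * rrTheta 3 (q ^ 5)))) := fun c hc => by
    rw [← tsum_fiveKernel hq hq1 hc]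
    exact tendsto_prod_jacobi hq hq1 (by simp [fiveKernel]) (by simp [fiveKernel])
      (fiveKernel_add_two hc) (summable_triangle_mul_abs hq hq1 (abs_fiveKernel_le hc))
  have h := ((lim ((√5 - 1) / 2) (by linear_combination h5 / 4)).mul
    (lim ((-√5 - 1) / 2) (by linear_combination h5 / 4))).mul (tendsto_qPoch hq hq1)
  have h2 := tendsto_nhds_unique (h.congr fun n => ?_) (tendsto_qPoch hp hp1)
  · have h3 := (eulerF_pos hq hq1).ne'
    field_simp at h2
    linear_combination h2 / 4 + (q ^ 2 * rrTheta 3 (q ^ 5) ^ 2 / 4) * h5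
  · rw [qPoch, qPoch, ← prod_mul_distrib, ← prod_mul_distrib]
    refine prod_congr rfl fun i _ => ?_
    rw [show (q ^ 5) ^ (i + 1) = (q ^ (i + 1)) ^ 5 by ring]
    generalize q ^ (i + 1) = x
    linear_combination (-x ^ 2 / 4 + x ^ 3 / 4) * h5

lemma neg_one_zpow_eq {a b : ℤ} (h : Even (a + b)) : (-1 : ℝ) ^ a = (-1) ^ b := by
  rcases Int.even_or_odd a with ha | ha
  · rw [ha.neg_one_zpow, ((Int.even_add.1 h).1 ha).neg_one_zpow]
  · have hb : Odd b := by
      rw [← Int.not_even_iff_odd] at ha ⊢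
      exact fun hb => ha ((Int.even_add.1 h).2 hb)
    rw [ha.neg_one_zpow, hb.neg_one_zpow]

lemma neg_one_zpow_eq_neg {a b : ℤ} (h : Odd (a + b)) : (-1 : ℝ) ^ a = -(-1) ^ b := by
  rw [neg_one_zpow_eq (a := a) (b := b + 1) (by rw [← add_assoc]; exact h.add_one),
    zpow_add₀ (by norm_num)]
  simp

/-- The general term of the `i`-th moment of an alternating theta series. -/
noncomputable def thetaTerm (c b : ℤ) (i : ℕ) (s : ℝ) (n : ℤ) : ℝ :=
  (-1) ^ n * ((c * n + b : ℤ) : ℝ) ^ i * s ^ ((c * n + b) ^ 2)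

lemma summable_int_pow_mul_zpow_sq {s : ℝ} (hs : 0 < s) (hs1 : s < 1) (i : ℕ) :
    Summable fun n : ℤ => ‖(n : ℝ) ^ i * s ^ (n ^ 2)‖ := by
  have h : Summable fun n : ℕ => ‖(n : ℝ) ^ i * s ^ ((n : ℤ) ^ 2)‖ := by
    refine Summable.of_nonneg_of_le (fun _ => norm_nonneg _) (fun n => ?_)
      (summable_pow_mul_geometric_of_norm_lt_one i
        (show ‖s‖ < 1 by rwa [Real.norm_of_nonneg hs.le]))
    rw [Real.norm_of_nonneg (by positivity),
      show (n : ℤ) ^ 2 = ((n ^ 2 : ℕ) : ℤ) from (Nat.cast_pow n 2).symm, zpow_natCast]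
    refine mul_le_mul_of_nonneg_left ?_ (by positivity)
    exact pow_le_pow_of_le_one hs.le hs1.le (Nat.le_self_pow two_ne_zero n)
  refine Summable.of_nat_of_neg (by simpa using h) ?_
  simpa [abs_mul, abs_pow] using h

lemma summable_norm_thetaTerm {s : ℝ} (hs : 0 < s) (hs1 : s < 1) {c : ℤ} (hc : c ≠ 0) (b : ℤ)
    (i : ℕ) : Summable fun n => ‖thetaTerm c b i s n‖ := by
  refine ((summable_int_pow_mul_zpow_sq hs hs1 i).comp_injective (i := fun n => c * n + b)
    fun m n h => ?_).congr fun n => ?_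
  · simpa [hc] using h
  · simp only [thetaTerm, Function.comp_apply, norm_mul, norm_zpow, norm_neg, norm_one, one_zpow,
      one_mul]

/-- The logarithmic derivative `q d/dq` of `rrTheta`. -/
noncomputable def rrThetaD (a : ℤ) (q : ℝ) : ℝ :=
  ∑' n : ℤ, (-1 : ℝ) ^ n * (thetaExp a n * q ^ thetaExp a n)

lemma sq_eq_thetaExp {a : ℤ} (ha : Odd a) (h0 : 0 < a) (h5 : a < 5) (n : ℤ) :
    (10 * n + a) ^ 2 = 40 * (thetaExp a n : ℤ) + a ^ 2 := by
  linear_combination -20 * two_mul_thetaExp ha h0 h5 n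

lemma thetaTerm_zero_eq {a : ℤ} (ha : Odd a) (h0 : 0 < a) (h5 : a < 5) {s : ℝ} (hs : 0 < s)
    (n : ℤ) : thetaTerm 10 a 0 s n = s ^ (a ^ 2) * ((-1) ^ n * (s ^ 40) ^ thetaExp a n) := by
  rw [thetaTerm, sq_eq_thetaExp ha h0 h5, zpow_add₀ hs.ne', zpow_mul, zpow_natCast, zpow_ofNat]
  ring

lemma thetaTerm_two_eq {a : ℤ} (ha : Odd a) (h0 : 0 < a) (h5 : a < 5) {s : ℝ} (hs : 0 < s)
    (n : ℤ) : thetaTerm 10 a 2 s n = s ^ (a ^ 2) *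
      (40 * ((-1) ^ n * (thetaExp a n * (s ^ 40) ^ thetaExp a n)) +
        a ^ 2 * ((-1) ^ n * (s ^ 40) ^ thetaExp a n)) := by
  have h : ((10 * n + a : ℤ) : ℝ) ^ 2 = 40 * thetaExp a n + a ^ 2 := by
    exact_mod_cast sq_eq_thetaExp ha h0 h5 n
  rw [thetaTerm, h, sq_eq_thetaExp ha h0 h5, zpow_add₀ hs.ne', zpow_mul, zpow_natCast, zpow_ofNat]
  ring

lemma tsum_thetaTerm_zero {a : ℤ} (ha : Odd a) (h0 : 0 < a) (h5 : a < 5) {s : ℝ} (hs : 0 < s) :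
    ∑' n, thetaTerm 10 a 0 s n = s ^ (a ^ 2) * rrTheta a (s ^ 40) := by
  simp only [thetaTerm_zero_eq ha h0 h5 hs, tsum_mul_left, rrTheta]

lemma tsum_thetaTerm_two {a : ℤ} (ha : Odd a) (h0 : 0 < a) (h5 : a < 5) {s : ℝ} (hs : 0 < s)
    (hs1 : s < 1) : ∑' n, thetaTerm 10 a 2 s n =
      s ^ (a ^ 2) * (40 * rrThetaD a (s ^ 40) + a ^ 2 * rrTheta a (s ^ 40)) := by
  have hA := summable_rrTheta ha h0 h5 (q := s ^ 40) (by positivity)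
    (pow_lt_one₀ hs.le hs1 (by norm_num))
  have hz : s ^ (a ^ 2) ≠ 0 := (zpow_pos hs _).ne'
  have h2 := (summable_norm_thetaTerm hs hs1 (c := 10) (by norm_num) a 2).of_norm
  rw [funext (thetaTerm_two_eq ha h0 h5 hs), summable_mul_left_iff hz] at h2
  simp only [thetaTerm_two_eq ha h0 h5 hs]
  have hD : Summable fun n : ℤ => 40 * ((-1) ^ n * (thetaExp a n * (s ^ 40) ^ thetaExp a n)) :=
    (h2.sub (hA.mul_left ((a : ℝ) ^ 2))).congr fun n => by ring
  rw [tsum_mul_left, hD.tsum_add (hA.mul_left _), tsum_mul_left, tsum_mul_left, rrTheta, rrThetaD]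

lemma tsum_thetaTerm_one {s : ℝ} (hs : 0 < s) (hs1 : s < 1) :
    ∑' n, thetaTerm 2 1 1 s n = 2 * s * eulerF (s ^ 8) ^ 3 := by
  have h := (summable_norm_thetaTerm hs hs1 (c := 2) (by norm_num) 1 1).of_norm
  have h1 : Summable fun k : ℕ => thetaTerm 2 1 1 s k :=
    h.comp_injective (i := fun k : ℕ => (k : ℤ)) fun _ _ h => by simpa using h
  have h2 : Summable fun k : ℕ => thetaTerm 2 1 1 s (-(k + 1)) :=
    h.comp_injective (i := fun k : ℕ => -((k : ℤ) + 1)) fun _ _ h => by simpa using h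
  have he : ∀ k : ℕ, thetaTerm 2 1 1 s k =
      s * ((-1 : ℝ) ^ k * (s ^ 8) ^ (k * (k + 1) / 2) * (2 * k + 1)) := fun k => by
    have t := two_mul_triangle k
    generalize k * (k + 1) / 2 = T at t ⊢
    have e : (2 * (k : ℤ) + 1) ^ 2 = 8 * (T : ℤ) + 1 := by zify at t; linear_combination -4 * t
    rw [thetaTerm, e, zpow_add₀ hs.ne', zpow_mul, zpow_one, zpow_natCast, zpow_natCast, zpow_ofNat]
    push_cast
    ring
  have he2 : ∀ k : ℕ, thetaTerm 2 1 1 s (-(k + 1)) = thetaTerm 2 1 1 s k := fun k => by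
    rw [thetaTerm, thetaTerm, neg_one_zpow_neg_add_one,
      show (2 * -((k : ℤ) + 1) + 1) = -(2 * k + 1) by ring, neg_sq, Int.cast_neg, pow_one, pow_one,
      zpow_natCast]
    ring
  rw [tsum_of_nat_of_neg_add_one h1 h2]
  simp only [he2, he, tsum_mul_left]
  rw [tsum_jacobi_cube (q := s ^ 8) (by positivity) (pow_lt_one₀ hs.le hs1 (by norm_num))]
  ring

/-- The decomposition of `ℤ²` into the five cosets of the image of `(m, n) ↦ (2 m + n, 2 n - m)`. -/
def fiveCosetEquiv : Fin 5 × ℤ × ℤ ≃ ℤ × ℤ where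
  toFun x := (2 * x.2.1 + x.2.2 + x.1.val, 2 * x.2.2 - x.2.1)
  invFun y := (⟨((y.1 + 2 * y.2) % 5).toNat, by lia⟩, 2 * ((y.1 + 2 * y.2) / 5) - y.2,
    (y.1 + 2 * y.2) / 5)
  left_inv := by
    rintro ⟨⟨r, hr⟩, m, n⟩
    ext <;> simp
    all_goals lia
  right_inv := by
    rintro ⟨p, t⟩
    ext <;> simp
    lia

/-- The signed kernel `(x² - y²) s^(x² + y²)`. -/
noncomputable def sqDiffKernel (s : ℝ) (x y : ℤ) : ℝ :=
  ((x ^ 2 - y ^ 2 : ℤ) : ℝ) * s ^ (x ^ 2 + y ^ 2)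

lemma sqDiffKernel_swap (s : ℝ) (x y : ℤ) : sqDiffKernel s x y = -sqDiffKernel s y x := by
  rw [sqDiffKernel, sqDiffKernel, add_comm]
  push_cast
  ring

lemma sqDiffKernel_congr (s : ℝ) {x y z w : ℤ} (h : x ^ 2 = z ^ 2) (h' : y ^ 2 = w ^ 2) :
    sqDiffKernel s x y = sqDiffKernel s z w := by
  rw [sqDiffKernel, sqDiffKernel, h, h']

lemma tsum_lattice {s : ℝ} (hsum : Summable fun x : ℤ × ℤ => (-1 : ℝ) ^ (x.1 + x.2) *
      sqDiffKernel s (4 * x.1 - 2 * x.2 + 1) (2 * x.1 + 4 * x.2 + 3)) :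
    ∑' x : ℤ × ℤ, (-1 : ℝ) ^ (x.1 + x.2) *
        sqDiffKernel s (4 * x.1 - 2 * x.2 + 1) (2 * x.1 + 4 * x.2 + 3) =
      -4 * ∑' x : ℤ × ℤ, (-1 : ℝ) ^ (x.1 + x.2) *
        sqDiffKernel s (10 * x.1 + 3) (10 * x.2 + 1) := by
  generalize hg : (fun x : ℤ × ℤ => (-1 : ℝ) ^ (x.1 + x.2) *
    sqDiffKernel s (4 * x.1 - 2 * x.2 + 1) (2 * x.1 + 4 * x.2 + 3)) = g at hsum ⊢
  generalize hh : (fun x : ℤ × ℤ => (-1 : ℝ) ^ (x.1 + x.2) *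
    sqDiffKernel s (10 * x.1 + 3) (10 * x.2 + 1)) = h
  have hval : ∀ (r : Fin 5) (x : ℤ × ℤ) (k : ℤ), (r.val : ℤ) = k →
      (g ∘ fiveCosetEquiv) (r, x) = (-1 : ℝ) ^ (x.1 + x.2 + k) *
        sqDiffKernel s (10 * x.1 + 4 * k + 1) (10 * x.2 + 2 * k + 3) := by
    rintro r x _ rfl
    simp only [← hg, fiveCosetEquiv, Function.comp_apply, Equiv.coe_fn_mk]
    congr 1
    · exact neg_one_zpow_eq ⟨x.1 + 2 * x.2 + r.val, by ring⟩
    · congr 1 <;> ring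
  have key : ∀ (e : ℤ × ℤ ≃ ℤ × ℤ) (r : Fin 5),
      (∀ x, (g ∘ fiveCosetEquiv) (r, x) = -h (e x)) →
      ∑' x, (g ∘ fiveCosetEquiv) (r, x) = -∑' x, h x := fun e r h => by
    rw [tsum_congr h, tsum_neg, e.tsum_eq]
  have h0 := key (Equiv.prodComm ℤ ℤ) 0 fun x => by
    simp only [hval 0 _ 0 rfl, ← hh, Equiv.prodComm_apply, Prod.fst_swap, Prod.snd_swap]
    rw [neg_one_zpow_eq (b := x.2 + x.1) ⟨x.1 + x.2, by ring⟩, sqDiffKernel_swap, mul_neg]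
    congr 2
    exact sqDiffKernel_congr s (by ring) (by ring)
  have h1 : ∑' x : ℤ × ℤ, (g ∘ fiveCosetEquiv) (1, x) = 0 := by
    have h := (Equiv.prodComm ℤ ℤ).tsum_eq fun x => (g ∘ fiveCosetEquiv) (1, x)
    have h' : ∀ x, (g ∘ fiveCosetEquiv) (1, Equiv.prodComm ℤ ℤ x) =
        -(g ∘ fiveCosetEquiv) (1, x) := fun x => by
      rw [hval 1 _ 1 rfl, hval 1 _ 1 rfl, sqDiffKernel_swap, mul_neg, Equiv.prodComm_apply,
        Prod.fst_swap, Prod.snd_swap, add_comm x.1 x.2]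
      congr 2
      exact sqDiffKernel_congr s (by ring) (by ring)
    rw [tsum_congr h', tsum_neg] at h
    linarith
  have h2 := key ⟨fun x => (-x.2 - 1, -x.1 - 1), fun x => (-x.2 - 1, -x.1 - 1), fun x => by simp,
      fun x => by simp⟩ 2 fun x => by
    simp only [hval 2 _ 2 rfl, ← hh, Equiv.coe_fn_mk]
    rw [neg_one_zpow_eq (b := -x.2 - 1 + (-x.1 - 1)) ⟨0, by ring⟩, sqDiffKernel_swap, mul_neg]
    congr 2
    exact sqDiffKernel_congr s (by ring) (by ring)
  have h3 := key ⟨fun x => (x.1 + 1, -x.2 - 1), fun x => (x.1 - 1, -x.2 - 1), fun x => by simp,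
      fun x => by simp⟩ 3 fun x => by
    simp only [hval 3 _ 3 rfl, ← hh, Equiv.coe_fn_mk]
    rw [neg_one_zpow_eq_neg (b := x.1 + 1 + (-x.2 - 1)) ⟨x.1 + 1, by ring⟩, neg_mul]
    congr 2
    exact sqDiffKernel_congr s (by ring) (by ring)
  have h4 := key ⟨fun x => (-x.1 - 2, x.2 + 1), fun x => (-x.1 - 2, x.2 - 1), fun x => by simp,
      fun x => by simp⟩ 4 fun x => by
    simp only [hval 4 _ 4 rfl, ← hh, Equiv.coe_fn_mk]
    rw [neg_one_zpow_eq_neg (b := -x.1 - 2 + (x.2 + 1)) ⟨x.2 + 1, by ring⟩, neg_mul]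
    congr 2
    exact sqDiffKernel_congr s (by ring) (by ring)
  rw [← fiveCosetEquiv.tsum_eq g]
  change ∑' x, (g ∘ fiveCosetEquiv) x = _
  rw [(fiveCosetEquiv.summable_iff.2 hsum).tsum_prod, tsum_fintype, Fin.sum_univ_five, h0, h1, h2,
    h3, h4]
  ring

/-- The Wronskian of the two Rogers–Ramanujan theta series. -/
lemma rrTheta_wronskian {q : ℝ} (hq : 0 < q) (hq1 : q < 1) :
    rrTheta 3 q * rrTheta 1 q + 5 * (rrThetaD 3 q * rrTheta 1 q - rrTheta 3 q * rrThetaD 1 q) =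
      eulerF q ^ 6 := by
  obtain ⟨s, hs, hs1, rfl⟩ : ∃ s : ℝ, 0 < s ∧ s < 1 ∧ s ^ 40 = q := by
    have h : (q ^ ((40 : ℕ) : ℝ)⁻¹) ^ 40 = q := Real.rpow_inv_natCast_pow hq.le (by norm_num)
    exact ⟨_, Real.rpow_pos_of_pos hq _, Real.rpow_lt_one hq.le hq1 (by positivity), h⟩
  have hp : 0 < s ^ 5 := by positivity
  have hp1 : s ^ 5 < 1 := pow_lt_one₀ hs.le hs1 (by norm_num)
  have o1 : Odd (1 : ℤ) := by decide
  have o3 : Odd (3 : ℤ) := by decide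
  have sM := fun i => summable_norm_thetaTerm hp hp1 (c := 2) (by norm_num) 1 i
  have sA := fun i => summable_norm_thetaTerm hs hs1 (c := 10) (by norm_num) 3 i
  have sB := fun i => summable_norm_thetaTerm hs hs1 (c := 10) (by norm_num) 1 i
  have m20 := summable_mul_of_summable_norm (sM 2) (sM 0)
  have m02 := summable_mul_of_summable_norm (sM 0) (sM 2)
  have m11 := summable_mul_of_summable_norm (sM 1) (sM 1)
  have ab20 := summable_mul_of_summable_norm (sA 2) (sB 0)
  have ab02 := summable_mul_of_summable_norm (sA 0) (sB 2)
  have e1 : ∀ x : ℤ × ℤ, (-1 : ℝ) ^ (x.1 + x.2) *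
        sqDiffKernel s (4 * x.1 - 2 * x.2 + 1) (2 * x.1 + 4 * x.2 + 3) =
      3 * (thetaTerm 2 1 2 (s ^ 5) x.1 * thetaTerm 2 1 0 (s ^ 5) x.2 -
        thetaTerm 2 1 0 (s ^ 5) x.1 * thetaTerm 2 1 2 (s ^ 5) x.2) -
      8 * (thetaTerm 2 1 1 (s ^ 5) x.1 * thetaTerm 2 1 1 (s ^ 5) x.2) := fun x => by
    rw [sqDiffKernel, show (4 * x.1 - 2 * x.2 + 1) ^ 2 + (2 * x.1 + 4 * x.2 + 3) ^ 2 =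
      5 * (2 * x.1 + 1) ^ 2 + 5 * (2 * x.2 + 1) ^ 2 by ring, zpow_add₀ hs.ne', zpow_mul, zpow_mul,
      zpow_add₀ (by norm_num)]
    simp only [thetaTerm]
    rw [show s ^ (5 : ℤ) = s ^ 5 by norm_cast]
    push_cast
    ring
  have e2 : ∀ x : ℤ × ℤ, (-1 : ℝ) ^ (x.1 + x.2) *
        sqDiffKernel s (10 * x.1 + 3) (10 * x.2 + 1) =
      thetaTerm 10 3 2 s x.1 * thetaTerm 10 1 0 s x.2 -
        thetaTerm 10 3 0 s x.1 * thetaTerm 10 1 2 s x.2 := fun x => by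
    rw [sqDiffKernel, zpow_add₀ hs.ne', zpow_add₀ (by norm_num)]
    simp only [thetaTerm]
    push_cast
    ring
  have hl := tsum_lattice (s := s) ((((m20.sub m02).mul_left 3).sub (m11.mul_left 8)).congr
    fun x => (e1 x).symm)
  simp only [e1, e2] at hl
  rw [((m20.sub m02).mul_left 3).tsum_sub (m11.mul_left 8), tsum_mul_left, tsum_mul_left,
    m20.tsum_sub m02, ab20.tsum_sub ab02,
    ← tsum_mul_tsum_of_summable_norm (sM 2) (sM 0), ← tsum_mul_tsum_of_summable_norm (sM 0) (sM 2),
    ← tsum_mul_tsum_of_summable_norm (sM 1) (sM 1), ← tsum_mul_tsum_of_summable_norm (sA 2) (sB 0),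
    ← tsum_mul_tsum_of_summable_norm (sA 0) (sB 2), tsum_thetaTerm_one hp hp1,
    tsum_thetaTerm_zero o1 (by norm_num) (by norm_num) hs,
    tsum_thetaTerm_zero o3 (by norm_num) (by norm_num) hs,
    tsum_thetaTerm_two o1 (by norm_num) (by norm_num) hs hs1,
    tsum_thetaTerm_two o3 (by norm_num) (by norm_num) hs hs1, ← pow_mul] at hl
  norm_num at hl
  have hs10 : s ^ 10 ≠ 0 := by positivity
  apply mul_left_cancel₀ hs10
  linear_combination hl / 32

lemma hasDerivAt_rrTheta {a : ℤ} (ha : Odd a) (h0 : 0 < a) (h5 : a < 5) {q : ℝ} (hq : |q| < 1) :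
    HasDerivAt (rrTheta a)
      (∑' n : ℤ, (-1 : ℝ) ^ n * (thetaExp a n * q ^ (thetaExp a n - 1))) q := by
  obtain ⟨r, hqr, hr1⟩ := exists_between hq
  have hr0 : 0 < r := (abs_nonneg q).trans_lt hqr
  have hu : Summable fun k : ℕ => (k : ℝ) * r ^ (k - 1) := by
    rw [← summable_nat_add_iff 1]
    refine ((summable_pow_mul_geometric_of_norm_lt_one 1
      (show ‖r‖ < 1 by rwa [Real.norm_of_nonneg hr0.le])).add
      (summable_geometric_of_lt_one hr0.le hr1)).congr fun k => ?_
    rw [Nat.add_sub_cancel]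
    push_cast
    ring
  refine hasDerivAt_tsum_of_isPreconnected
    (hu.comp_injective (thetaExp_injective ha h0 h5)) (t := Set.Ioo (-r) r) isOpen_Ioo
    isPreconnected_Ioo (fun n y _ => (hasDerivAt_pow _ y).const_mul _) (fun n y hy => ?_)
    (y₀ := r / 2) ⟨by linarith, by linarith⟩
    (summable_rrTheta ha h0 h5 (by linarith) (by linarith)) (abs_lt.1 hqr)
  rw [norm_mul, Real.norm_eq_abs, abs_neg_one_zpow, one_mul, norm_mul, norm_pow,
    Real.norm_of_nonneg (Nat.cast_nonneg _), Real.norm_eq_abs]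
  have := (abs_lt.2 hy).le
  simp only [Function.comp_apply]
  gcongr

lemma rrThetaD_eq (a : ℤ) (q : ℝ) :
    rrThetaD a q = q * ∑' n : ℤ, (-1 : ℝ) ^ n * (thetaExp a n * q ^ (thetaExp a n - 1)) := by
  rw [rrThetaD, ← tsum_mul_left]
  refine tsum_congr fun n => ?_
  rcases Nat.eq_zero_or_pos (thetaExp a n) with h | h
  · simp [h]
  · obtain ⟨k, hk⟩ := Nat.exists_eq_add_of_lt h
    rw [hk]
    simp only [zero_add, Nat.add_sub_cancel]
    ring

lemma hasDerivAt_rrTheta_of_pos {a : ℤ} (ha : Odd a) (h0 : 0 < a) (h5 : a < 5) {q : ℝ}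
    (hq : 0 < q) (hq1 : q < 1) : HasDerivAt (rrTheta a) (rrThetaD a q / q) q := by
  rw [rrThetaD_eq, mul_div_cancel_left₀ _ hq.ne']
  exact hasDerivAt_rrTheta ha h0 h5 (abs_lt.2 ⟨by linarith, hq1⟩)

lemma rrTheta_zero {a : ℤ} (ha : Odd a) (h0 : 0 < a) (h5 : a < 5) : rrTheta a 0 = 1 := by
  rw [rrTheta, tsum_eq_single 0]
  · simp [thetaExp]
  · intro n hn
    have h : thetaExp a n ≠ 0 := fun h =>
      hn (thetaExp_injective ha h0 h5 (h.trans (by simp [thetaExp])))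
    simp [h]

/-- The Rogers–Ramanujan continued fraction as a quotient of theta series. -/
noncomputable def rrQuot (q : ℝ) : ℝ := q ^ ((1 : ℝ) / 5) * rrTheta 3 q / rrTheta 1 q

lemma rrQuot_pos {q : ℝ} (hq : 0 < q) (hq1 : q < 1) : 0 < rrQuot q :=
  div_pos (mul_pos (rpow_pos_of_pos hq _) (rrTheta_three_pos hq hq1)) (rrTheta_one_pos hq hq1)

lemma rpow_one_div_five_pow {q : ℝ} (hq : 0 < q) : (q ^ ((1 : ℝ) / 5)) ^ 5 = q := by
  rw [← rpow_natCast, ← rpow_mul hq.le]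
  norm_num

lemma rpow_four_div_five_mul {q : ℝ} (hq : 0 < q) :
    q ^ ((4 : ℝ) / 5) * q ^ ((1 : ℝ) / 5) = q := by
  rw [← rpow_add hq]
  norm_num

lemma one_sub_rrQuot_sub_sq {q : ℝ} (hq : 0 < q) (hq1 : q < 1) :
    1 - rrQuot q - rrQuot q ^ 2 = eulerF (q ^ ((1 : ℝ) / 5)) * eulerF q / rrTheta 1 q ^ 2 := by
  have h := rrTheta_sq_sub (q := q ^ ((1 : ℝ) / 5)) (rpow_pos_of_pos hq _)
    (rpow_lt_one hq.le hq1 (by norm_num))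
  rw [rpow_one_div_five_pow hq] at h
  have hB := (rrTheta_one_pos hq hq1).ne'
  rw [← h, rrQuot]
  field_simp

lemma eulerF_rpow_pos {q : ℝ} (hq : 0 < q) (hq1 : q < 1) : 0 < eulerF (q ^ ((1 : ℝ) / 5)) :=
  eulerF_pos (rpow_pos_of_pos hq _) (rpow_lt_one hq.le hq1 (by norm_num))

lemma yF_eq {q : ℝ} (hq : 0 < q) (hq1 : q < 1) : yF q = 1 / rrQuot q - 1 - rrQuot q := by
  have h := one_sub_rrQuot_sub_sq hq hq1
  have hR := (rrQuot_pos hq hq1).ne'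
  have hA := (rrTheta_three_pos hq hq1).ne'
  have hB := (rrTheta_one_pos hq hq1).ne'
  have hu := (rpow_pos_of_pos hq ((1 : ℝ) / 5)).ne'
  have hf := (eulerF_pos hq hq1).ne'
  have hf5 := (eulerF_pos (q := q ^ 5) (by positivity)
    (pow_lt_one₀ hq.le hq1 (by norm_num))).ne'
  have hAB := rrTheta_three_mul_rrTheta_one hq hq1
  rw [show 1 / rrQuot q - 1 - rrQuot q = (1 - rrQuot q - rrQuot q ^ 2) / rrQuot q by field_simp,
    h, yF, rrQuot]
  field_simp
  linear_combination eulerF (q ^ ((1 : ℝ) / 5)) * hAB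

lemma RRcf_eq_rrQuot {q : ℝ} (hq : 0 < q) (hq1 : q < 1) : RRcf q = rrQuot q := by
  have hR := rrQuot_pos hq hq1
  have h : yF q ^ 2 + 2 * yF q + 5 = (1 / rrQuot q + rrQuot q) ^ 2 := by
    rw [yF_eq hq hq1]
    field_simp
    ring
  rw [RRcf, h, Real.sqrt_sq (by positivity), yF_eq hq hq1]
  ring

lemma hasDerivAt_rrQuot {q : ℝ} (hq : 0 < q) (hq1 : q < 1) :
    HasDerivAt rrQuot (q ^ ((1 : ℝ) / 5) * eulerF q ^ 6 / (5 * q * rrTheta 1 q ^ 2)) q := by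
  have hB := (rrTheta_one_pos hq hq1).ne'
  have h := ((hasDerivAt_rpow_const (p := (1 : ℝ) / 5) (Or.inl hq.ne')).mul
    (hasDerivAt_rrTheta_of_pos (a := 3) (by decide) (by norm_num) (by norm_num) hq hq1)).div
    (hasDerivAt_rrTheta_of_pos (a := 1) (by decide) (by norm_num) (by norm_num) hq hq1) hB
  refine h.congr_deriv ?_
  rw [← rrTheta_wronskian hq hq1, rpow_sub_one hq.ne']
  simp only [Pi.mul_apply]
  field_simp
  ring

lemma continuousOn_rrQuot {q : ℝ} (hq1 : q < 1) : ContinuousOn rrQuot (Set.Icc 0 q) := by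
  have hc : ∀ a : ℤ, Odd a → 0 < a → a < 5 → ContinuousOn (rrTheta a) (Set.Icc 0 q) :=
    fun a ha h0 h5 x hx => (hasDerivAt_rrTheta ha h0 h5
      (abs_lt.2 ⟨by linarith [hx.1], by linarith [hx.2]⟩)).continuousAt.continuousWithinAt
  refine ((continuousOn_id.rpow_const fun _ _ => Or.inr (by norm_num)).mul
    (hc 3 (by decide) (by norm_num) (by norm_num))).div
    (hc 1 (by decide) (by norm_num) (by norm_num)) fun x hx => ?_
  rcases hx.1.eq_or_lt with rfl | h
  · rw [rrTheta_zero (by decide) (by norm_num) (by norm_num)]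
    exact one_ne_zero
  · exact (rrTheta_one_pos h (hx.2.trans_lt hq1)).ne'

lemma rrQuot_zero : rrQuot 0 = 0 := by
  rw [rrQuot, zero_rpow (by norm_num), zero_mul, zero_div]

lemma rrQuot_lt {q : ℝ} (hq : 0 ≤ q) (hq1 : q < 1) : 0 ≤ rrQuot q ∧ rrQuot q < (√5 - 1) / 2 := by
  have h5 : √5 ^ 2 = (5 : ℝ) := Real.sq_sqrt (by norm_num)
  have h52 : 2 < √5 := Real.lt_sqrt_of_sq_lt (by norm_num)
  rcases hq.eq_or_lt with rfl | h
  · rw [rrQuot_zero]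
    exact ⟨le_rfl, by linarith⟩
  · have hR := rrQuot_pos h hq1
    refine ⟨hR.le, ?_⟩
    have hpos : 0 < 1 - rrQuot q - rrQuot q ^ 2 := by
      rw [one_sub_rrQuot_sub_sq h hq1]
      exact div_pos (mul_pos (eulerF_rpow_pos h hq1) (eulerF_pos h hq1))
        (pow_pos (rrTheta_one_pos h hq1) 2)
    have hfac : 1 - rrQuot q - rrQuot q ^ 2 =
        (rrQuot q + (√5 + 1) / 2) * ((√5 - 1) / 2 - rrQuot q) := by
      linear_combination -h5 / 4
    rw [hfac] at hpos
    linarith [pos_of_mul_pos_right hpos (by linarith)]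

/-- Antiderivative of the integrand in the integral formula. -/
noncomputable def rrLog (q : ℝ) : ℝ :=
  √5 * Real.log ((rrQuot q + (√5 + 1) / 2) / ((√5 - 1) / 2 - rrQuot q))

lemma continuousOn_rrLog {q : ℝ} (hq1 : q < 1) : ContinuousOn rrLog (Set.Icc 0 q) := by
  have h52 : 2 < √5 := Real.lt_sqrt_of_sq_lt (by norm_num)
  have hc := continuousOn_rrQuot hq1
  have hlt : ∀ x ∈ Set.Icc 0 q, 0 ≤ rrQuot x ∧ rrQuot x < (√5 - 1) / 2 := fun x hx =>
    rrQuot_lt hx.1 (hx.2.trans_lt hq1)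
  refine continuousOn_const.mul (((hc.add continuousOn_const).div (continuousOn_const.sub hc)
    fun x hx => ?_).log fun x hx => ?_)
  · exact (sub_pos.2 (hlt x hx).2).ne'
  · exact (div_pos (add_pos_of_nonneg_of_pos (hlt x hx).1 (by linarith))
      (sub_pos.2 (hlt x hx).2)).ne'

lemma hasDerivAt_rrLog {q : ℝ} (hq : 0 < q) (hq1 : q < 1) : HasDerivAt rrLog
    (eulerF q ^ 5 / (eulerF (q ^ ((1 : ℝ) / 5)) * q ^ ((4 : ℝ) / 5))) q := by
  have h5 : √5 ^ 2 = (5 : ℝ) := Real.sq_sqrt (by norm_num)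
  have h52 : 2 < √5 := Real.lt_sqrt_of_sq_lt (by norm_num)
  have hlt := rrQuot_lt hq.le hq1
  have hR := hasDerivAt_rrQuot hq hq1
  have hn : rrQuot q + (√5 + 1) / 2 ≠ 0 := by linarith
  have hd : (√5 - 1) / 2 - rrQuot q ≠ 0 := by linarith
  have h := (((hR.add_const ((√5 + 1) / 2)).div (hR.const_sub ((√5 - 1) / 2)) hd).log
    (div_ne_zero hn hd)).const_mul √5
  refine h.congr_deriv ?_
  have hfac : (rrQuot q + (√5 + 1) / 2) * ((√5 - 1) / 2 - rrQuot q) =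
      eulerF (q ^ ((1 : ℝ) / 5)) * eulerF q / rrTheta 1 q ^ 2 := by
    rw [← one_sub_rrQuot_sub_sq hq hq1]
    linear_combination h5 / 4
  have hB := (rrTheta_one_pos hq hq1).ne'
  have hu := (rpow_pos_of_pos hq ((1 : ℝ) / 5)).ne'
  have hf := (eulerF_pos hq hq1).ne'
  have hf5 := (eulerF_rpow_pos hq hq1).ne'
  have h4 := rpow_four_div_five_mul hq
  have h4n := (rpow_pos_of_pos hq ((4 : ℝ) / 5)).ne'
  generalize hD : q ^ ((1 : ℝ) / 5) * eulerF q ^ 6 / (5 * q * rrTheta 1 q ^ 2) = D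
  calc _ = √5 ^ 2 * D / ((rrQuot q + (√5 + 1) / 2) * ((√5 - 1) / 2 - rrQuot q)) := by
        have hs : (rrQuot q + (√5 + 1) / 2) + ((√5 - 1) / 2 - rrQuot q) = √5 := by ring
        simp only [Pi.div_apply]
        generalize rrQuot q + (√5 + 1) / 2 = N at hn hs ⊢
        generalize (√5 - 1) / 2 - rrQuot q = M at hd hs ⊢
        rw [← hs]
        field_simp
        ring
    _ = _ := by
        rw [hfac, h5, ← hD]
        generalize q ^ ((4 : ℝ) / 5) = w at h4 h4n
        generalize eulerF (q ^ ((1 : ℝ) / 5)) = F at hf5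
        generalize q ^ ((1 : ℝ) / 5) = u at h4 hu
        generalize rrTheta 1 q = B at hB
        generalize eulerF q = f at hf
        rw [← h4]
        field_simp

end

theorem ramanujan_son_formula (q : ℝ) (hq : 0 < q) (hq1 : q < 1) :
    IntervalIntegrable
        (fun t => eulerF t ^ 5 / (eulerF (t ^ ((1 : ℝ) / 5)) * t ^ ((4 : ℝ) / 5)))
        volume 0 q ∧
      RRcf q = (Real.sqrt 5 - 1) / 2 -
        Real.sqrt 5 /
          (1 + ((3 + Real.sqrt 5) / 2) *
            Real.exp ((1 / Real.sqrt 5) *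
              ∫ t in (0:ℝ)..q,
                eulerF t ^ 5 / (eulerF (t ^ ((1 : ℝ) / 5)) * t ^ ((4 : ℝ) / 5)))) := by
  have h5 : √5 ^ 2 = (5 : ℝ) := Real.sq_sqrt (by norm_num)
  have h52 : 2 < √5 := Real.lt_sqrt_of_sq_lt (by norm_num)
  have hderiv : ∀ x ∈ Set.Ioo 0 q, HasDerivAt rrLog
      (eulerF x ^ 5 / (eulerF (x ^ ((1 : ℝ) / 5)) * x ^ ((4 : ℝ) / 5))) x := fun x hx =>
    hasDerivAt_rrLog hx.1 (hx.2.trans hq1)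
  have hcont := continuousOn_rrLog hq1
  have hint := intervalIntegral.intervalIntegrable_deriv_of_nonneg (a := 0) (b := q)
    (by rwa [Set.uIcc_of_le hq.le]) (by rwa [min_eq_left hq.le, max_eq_right hq.le])
    (by
      rw [min_eq_left hq.le, max_eq_right hq.le]
      intro x hx
      have hx1 := hx.2.trans hq1
      exact (div_pos (pow_pos (eulerF_pos hx.1 hx1) 5)
        (mul_pos (eulerF_rpow_pos hx.1 hx1) (rpow_pos_of_pos hx.1 _))).le)
  refine ⟨hint, ?_⟩
  have hlt := rrQuot_lt hq.le hq1
  have hn : 0 < rrQuot q + (√5 + 1) / 2 := by linarith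
  have hd : 0 < (√5 - 1) / 2 - rrQuot q := by linarith
  have hm : 0 < (√5 - 1) / 2 := by linarith
  have hp : 0 < (√5 + 1) / 2 := by linarith
  have hconst : (3 + √5) / 2 = (√5 + 1) / 2 / ((√5 - 1) / 2) := by
    rw [eq_div_iff hm.ne']
    linear_combination h5 / 4
  have hsum : 1 + (rrQuot q + (√5 + 1) / 2) / ((√5 - 1) / 2 - rrQuot q) =
      √5 / ((√5 - 1) / 2 - rrQuot q) := by
    rw [eq_div_iff hd.ne', add_mul, div_mul_cancel₀ _ hd.ne']
    ring
  rw [intervalIntegral.integral_eq_sub_of_hasDerivAt_of_le hq.le hcont hderiv hint,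
    RRcf_eq_rrQuot hq hq1, rrLog, rrLog, rrQuot_zero, ← mul_sub, one_div,
    inv_mul_cancel_left₀ (by linarith), zero_add, sub_zero, exp_sub, exp_log (div_pos hn hd),
    exp_log (div_pos hp hm), hconst, mul_div_cancel₀ _ (div_pos hp hm).ne', hsum,
    div_div_cancel₀ (by linarith)]
  ring
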